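/- arXiv:1411.3609 — 2 statements merged into one kernel-verified Lean document; each statement's English description precedes it below -/
import Mathlib

section
/- Let f be an absolutely continuous probability density on ℝ with a.e. derivative f′, satisfying condition (F.2) with j = 2, and with finite Fisher information I(f) = ∫ (f′(x))²/f(x) dx. Let k₁ be a probability density on ℝ with ∫ u² k₁(u) du < ∞, and let q_n(x) = ∫ f(x − n^{-1/2}u) k₁(u) du. Then limsup_{n→∞} n ∫ (√(q_n(x)) − √(f(x)))² dx ≤ 2 I(f) ∫ u² k₁(u) du < ∞. -/
open MeasureTheory Filter Topology

open scoped ENNReal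

/-- A function whose increments are dominated by a multiple of those of an absolutely continuous
function is absolutely continuous. -/
lemma AbsolutelyContinuousOnInterval.of_dist_le {f g : ℝ → ℝ} {a b C : ℝ}
    (hf : AbsolutelyContinuousOnInterval f a b)
    (h : ∀ x y, dist (g x) (g y) ≤ C * dist (f x) (f y)) :
    AbsolutelyContinuousOnInterval g a b := by
  have h0 := Tendsto.const_mul C hf
  rw [mul_zero] at h0
  refine squeeze_zero (fun E => Finset.sum_nonneg fun _ _ => dist_nonneg) (fun E => ?_) h0
  rw [Finset.mul_sum]
  exact Finset.sum_le_sum fun i _ => h _ _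

lemma dist_sqrt_add_le {a b ε : ℝ} (ha : 0 ≤ a) (hb : 0 ≤ b) (hε : 0 < ε) :
    dist √(a + ε) √(b + ε) ≤ (√ε)⁻¹ * dist a b := by
  have hs : 0 < √ε := Real.sqrt_pos.2 hε
  rw [inv_mul_eq_div, le_div_iff₀ hs, Real.dist_eq, Real.dist_eq]
  have h1 : a - b = (√(a + ε) - √(b + ε)) * (√(a + ε) + √(b + ε)) := by
    have ha' := Real.sq_sqrt (show 0 ≤ a + ε by positivity)
    have hb' := Real.sq_sqrt (show 0 ≤ b + ε by positivity)
    linear_combination hb' - ha'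
  rw [h1, abs_mul, abs_of_nonneg (show 0 ≤ √(a + ε) + √(b + ε) by positivity)]
  have h2 : √ε ≤ √(a + ε) := Real.sqrt_le_sqrt (by linarith)
  have h3 : 0 ≤ √(b + ε) := Real.sqrt_nonneg _
  gcongr
  linarith

/-- If a density `f` satisfies the fundamental theorem of calculus with `f'` for every interval,
then `f'` is locally integrable. -/
lemma locallyIntegrable_of_sub_eq_integral {f f' : ℝ → ℝ}
    (hprob : ∫⁻ x, ENNReal.ofReal (f x) = 1)
    (hAC : ∀ a b : ℝ, f b - f a = ∫ t in a..b, f' t) : LocallyIntegrable f' := by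
  intro c
  by_contra hc
  have key : ∀ a b, a < c → c < b → f b = f a := by
    intro a b ha hb
    have hn : ¬ IntervalIntegrable f' volume a b := by
      intro hi
      rw [intervalIntegrable_iff_integrableOn_Ioc_of_le (ha.trans hb).le] at hi
      exact hc ⟨_, Ioc_mem_nhds ha hb, hi⟩
    have := hAC a b
    rw [intervalIntegral.integral_undef hn] at this
    linarith
  have hae : (fun x => ENNReal.ofReal (f x)) =ᵐ[volume] fun _ => ENNReal.ofReal (f (c + 1)) := by
    have hne : ∀ᵐ x : ℝ, x ≠ c := by simp [ae_iff, measure_singleton]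
    filter_upwards [hne] with x hx
    rcases lt_or_gt_of_ne hx with h | h
    · rw [key x (c + 1) h (by linarith)]
    · rw [key (c - 1) x (by linarith) h, key (c - 1) (c + 1) (by linarith) (by linarith)]
  rw [lintegral_congr_ae hae, lintegral_const, Real.volume_univ] at hprob
  by_cases h0 : ENNReal.ofReal (f (c + 1)) = 0
  · simp [h0] at hprob
  · simp [ENNReal.mul_top h0] at hprob

lemma hasDerivAt_ae_of_sub_eq_integral {f f' : ℝ → ℝ} (hloc : LocallyIntegrable f')
    (hAC : ∀ a b : ℝ, f b - f a = ∫ t in a..b, f' t) : ∀ᵐ x, HasDerivAt f (f' x) x := by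
  filter_upwards [LocallyIntegrable.ae_hasDerivAt_integral hloc] with x hx
  have h : f = fun x => f 0 + ∫ t in (0 : ℝ)..x, f' t := by
    funext y
    rw [← hAC]
    ring
  rw [h]
  exact (hx 0).const_add _

lemma absolutelyContinuousOnInterval_of_sub_eq_integral {f f' : ℝ → ℝ}
    (hloc : LocallyIntegrable f')
    (hAC : ∀ a b : ℝ, f b - f a = ∫ t in a..b, f' t) (a b : ℝ) :
    AbsolutelyContinuousOnInterval f a b := by
  have hi : IntervalIntegrable f' volume a b :=
    intervalIntegrable_iff.mpr <|
      (hloc.integrableOn_isCompact isCompact_uIcc).mono_set Set.uIoc_subset_uIcc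
  refine (hi.absolutelyContinuousOnInterval_intervalIntegral (c := a) (by simp)).of_dist_le
    (C := 1) fun x y => ?_
  simp only [← hAC, Real.dist_eq]
  ring_nf
  rfl

lemma sq_lintegral_le {α : Type*} [MeasurableSpace α] (μ : Measure α) {h : α → ℝ≥0∞}
    (hh : AEMeasurable h μ) : (∫⁻ x, h x ∂μ) ^ 2 ≤ μ Set.univ * ∫⁻ x, h x ^ 2 ∂μ := by
  have := ENNReal.lintegral_mul_le_Lp_mul_Lq μ (p := 2) (q := 2)
    (by constructor <;> norm_num) (f := fun _ => 1) (g := h) aemeasurable_const hh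
  simp only [Pi.mul_apply, one_mul, ENNReal.one_rpow, lintegral_const] at this
  calc _ ≤ ((μ Set.univ) ^ (1 / 2 : ℝ) * (∫⁻ x, h x ^ (2 : ℝ) ∂μ) ^ (1 / 2 : ℝ)) ^ 2 := by gcongr
    _ = _ := by
      rw [mul_pow, ← ENNReal.rpow_natCast, ← ENNReal.rpow_natCast, ← ENNReal.rpow_mul,
        ← ENNReal.rpow_mul]
      norm_num

/-- Cauchy-Schwarz bound for the increments of the square root of an absolutely continuous
nonnegative function. -/
lemma sq_sqrt_sub_sqrt_le {f f' : ℝ → ℝ} (hf : ∀ x, 0 ≤ f x) (hloc : LocallyIntegrable f')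
    (hAC : ∀ a b : ℝ, f b - f a = ∫ t in a..b, f' t) {a b : ℝ} (hab : a ≤ b) :
    ENNReal.ofReal ((√(f b) - √(f a)) ^ 2) ≤
      ENNReal.ofReal (b - a) * ∫⁻ t in Set.Ioc a b, ENNReal.ofReal (f' t ^ 2 / f t / 4) := by
  have hreg : ∀ ε : ℝ, 0 < ε → ENNReal.ofReal ((√(f b + ε) - √(f a + ε)) ^ 2) ≤
      ENNReal.ofReal (b - a) * ∫⁻ t in Set.Ioc a b, ENNReal.ofReal (f' t ^ 2 / f t / 4) := by
    intro ε hε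
    set G : ℝ → ℝ := fun x => √(f x + ε) with hG
    have hGac : AbsolutelyContinuousOnInterval G a b :=
      (absolutelyContinuousOnInterval_of_sub_eq_integral hloc hAC a b).of_dist_le
        fun x y => dist_sqrt_add_le (hf x) (hf y) hε
    have hae : ∀ᵐ t, ‖deriv G t‖ₑ ^ 2 ≤ ENNReal.ofReal (f' t ^ 2 / f t / 4) := by
      filter_upwards [hasDerivAt_ae_of_sub_eq_integral hloc hAC] with t ht
      have hpos : 0 < f t + ε := by linarith [hf t]
      have hd : HasDerivAt G (f' t / (2 * √(f t + ε))) t := (ht.add_const ε).sqrt hpos.ne'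
      rw [hd.deriv, Real.enorm_eq_ofReal_abs, ← ENNReal.ofReal_pow (abs_nonneg _), sq_abs]
      apply ENNReal.ofReal_le_ofReal
      rw [div_pow, mul_pow, Real.sq_sqrt hpos.le]
      rcases (hf t).eq_or_lt with h0 | h0
      · have hmin : IsLocalMin f t := Eventually.of_forall fun y => by rw [← h0]; exact hf y
        rw [hmin.hasDerivAt_eq_zero ht]
        simp
      · rw [div_div]
        exact div_le_div_of_nonneg_left (sq_nonneg _) (by positivity) (by linarith)
    have hmeas : Measurable (deriv G) := measurable_deriv G
    calc ENNReal.ofReal ((G b - G a) ^ 2) = ‖∫ t in a..b, deriv G t‖ₑ ^ 2 := by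
          rw [hGac.integral_deriv_eq_sub, Real.enorm_eq_ofReal_abs,
            ← ENNReal.ofReal_pow (abs_nonneg _), sq_abs]
      _ ≤ (∫⁻ t in Set.Ioc a b, ‖deriv G t‖ₑ) ^ 2 := by
          rw [intervalIntegral.integral_of_le hab]
          gcongr
          exact enorm_integral_le_lintegral_enorm _
      _ ≤ _ := sq_lintegral_le _ hmeas.enorm.aemeasurable
      _ ≤ _ := by
          rw [Measure.restrict_apply_univ, Real.volume_Ioc]
          gcongr 1
          exact lintegral_mono_ae (ae_restrict_of_ae hae)
  have hcont : Continuous fun ε : ℝ => ENNReal.ofReal ((√(f b + ε) - √(f a + ε)) ^ 2) :=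
    ENNReal.continuous_ofReal.comp (by fun_prop)
  have hlim := (hcont.tendsto 0).mono_left (nhdsWithin_le_nhds (s := Set.Ioi 0))
  simp only [add_zero] at hlim
  exact le_of_tendsto hlim (eventually_nhdsWithin_of_forall hreg)

lemma lintegral_setLIntegral_Ioc_add {F : ℝ → ℝ≥0∞} (hF : Measurable F) (h : ℝ) :
    ∫⁻ x, ∫⁻ t in Set.Ioc x (x + h), F t = ENNReal.ofReal h * ∫⁻ x, F x := by
  have h1 : ∀ x, ∫⁻ t in Set.Ioc x (x + h), F t = ∫⁻ s in Set.Ioc 0 h, F (x + s) := by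
    intro x
    rw [← lintegral_indicator measurableSet_Ioc, ← lintegral_indicator measurableSet_Ioc,
      ← lintegral_add_left_eq_self _ x]
    congr with s
    simp [Set.indicator]
  simp_rw [h1]
  rw [lintegral_lintegral_swap (by fun_prop)]
  simp_rw [lintegral_add_right_eq_self F]
  simp [mul_comm]

/-- Translation bound for `√f` in `L²` in terms of the Fisher information of `f`. -/
lemma lintegral_sq_sqrt_sub_sqrt_le {f f' : ℝ → ℝ} (hfm : Measurable f) (hfm' : Measurable f')
    (hf : ∀ x, 0 ≤ f x) (hloc : LocallyIntegrable f')
    (hAC : ∀ a b : ℝ, f b - f a = ∫ t in a..b, f' t) (h : ℝ) :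
    ∫⁻ x, ENNReal.ofReal ((√(f (x - h)) - √(f x)) ^ 2) ≤
      ENNReal.ofReal (h ^ 2) * ∫⁻ t, ENNReal.ofReal (f' t ^ 2 / f t / 4) := by
  have hpos : ∀ h : ℝ, 0 ≤ h → ∫⁻ x, ENNReal.ofReal ((√(f (x + h)) - √(f x)) ^ 2) ≤
      ENNReal.ofReal (h ^ 2) * ∫⁻ t, ENNReal.ofReal (f' t ^ 2 / f t / 4) := by
    intro h hh
    calc _ ≤ ∫⁻ x, ENNReal.ofReal h *
            ∫⁻ t in Set.Ioc x (x + h), ENNReal.ofReal (f' t ^ 2 / f t / 4) := by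
          refine lintegral_mono fun x => ?_
          simpa using sq_sqrt_sub_sqrt_le hf hloc hAC (show x ≤ x + h by linarith)
      _ = _ := by
          rw [lintegral_const_mul' _ _ ENNReal.ofReal_ne_top,
            lintegral_setLIntegral_Ioc_add (by fun_prop), ← mul_assoc, ← ENNReal.ofReal_mul hh,
            ← sq]
  rcases le_total h 0 with hh | hh
  · simpa [sub_eq_add_neg] using hpos (-h) (by linarith)
  · rw [← lintegral_add_right_eq_self _ h]
    simp only [add_sub_cancel_right]
    simp_rw [sub_sq_comm (√(f _)) √(f (_ + h))]
    exact hpos h hh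

/-- Reverse triangle inequality in `L²` of a probability measure, against a constant. -/
lemma sq_sqrt_integral_sq_sub_le {α : Type*} [MeasurableSpace α] (ν : Measure α)
    [IsProbabilityMeasure ν] {a : α → ℝ} (ham : Measurable a) {c : ℝ} (hc : 0 ≤ c) :
    ENNReal.ofReal ((√(∫ u, a u ^ 2 ∂ν) - c) ^ 2) ≤ ∫⁻ u, ENNReal.ofReal ((a u - c) ^ 2) ∂ν := by
  by_cases htop : ∫⁻ u, ENNReal.ofReal ((a u - c) ^ 2) ∂ν = ⊤
  · simp [htop]
  have hsub : MemLp (fun u => a u - c) 2 ν := by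
    rw [memLp_two_iff_integrable_sq (by fun_prop)]
    refine ⟨by fun_prop, ?_⟩
    rw [hasFiniteIntegral_iff_ofReal (Eventually.of_forall fun u => sq_nonneg _)]
    exact lt_top_iff_ne_top.2 htop
  have hL2 : MemLp a 2 ν := by
    convert hsub.add (memLp_const c) using 1
    ext u
    simp
  have hi : Integrable a ν := hL2.integrable (by norm_num)
  have hi2 : Integrable (fun u => a u ^ 2) ν := hL2.integrable_sq
  have hexp : ∀ d : ℝ, ∫ u, (a u - d) ^ 2 ∂ν = ∫ u, a u ^ 2 ∂ν - 2 * d * ∫ u, a u ∂ν + d ^ 2 := by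
    intro d
    have : ∀ u, (a u - d) ^ 2 = a u ^ 2 - 2 * d * a u + d ^ 2 := fun u => by ring
    simp_rw [this]
    rw [integral_add (f := fun u => a u ^ 2 - 2 * d * a u) (hi2.sub (hi.const_mul _))
      (integrable_const _), integral_sub hi2 (hi.const_mul _), integral_const_mul]
    simp
  rw [← ofReal_integral_eq_lintegral_ofReal hsub.integrable_sq
    (Eventually.of_forall fun u => sq_nonneg _)]
  apply ENNReal.ofReal_le_ofReal
  rw [hexp]
  have hA : 0 ≤ ∫ u, a u ^ 2 ∂ν := integral_nonneg fun u => sq_nonneg _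
  have hm : ∫ u, a u ∂ν ≤ √(∫ u, a u ^ 2 ∂ν) := by
    apply Real.le_sqrt_of_sq_le
    have : 0 ≤ ∫ u, (a u - ∫ u, a u ∂ν) ^ 2 ∂ν := integral_nonneg fun u => sq_nonneg _
    rw [hexp] at this
    linarith
  nlinarith [Real.sq_sqrt hA, mul_le_mul_of_nonneg_left hm hc]

lemma ofReal_integral_le_lintegral_ofReal {α : Type*} [MeasurableSpace α] {μ : Measure α}
    {F : α → ℝ} (hF : ∀ x, 0 ≤ F x) :
    ENNReal.ofReal (∫ x, F x ∂μ) ≤ ∫⁻ x, ENNReal.ofReal (F x) ∂μ := by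
  by_cases h : Integrable F μ
  · rw [ofReal_integral_eq_lintegral_ofReal h (Eventually.of_forall hF)]
  · simp [integral_undef h]

/-- Non-asymptotic Hellinger bound for the scale mixture `x ↦ ∫ f (x - h u) k(u) du`. -/
lemma integral_sq_sqrt_mixture_sub_sqrt_le {f f' k : ℝ → ℝ}
    (hfm : Measurable f) (hfm' : Measurable f') (hkm : Measurable k)
    (hf : ∀ x, 0 ≤ f x) (hk : ∀ x, 0 ≤ k x)
    (hk_prob : ∫⁻ x, ENNReal.ofReal (k x) = 1) (hloc : LocallyIntegrable f')
    (hAC : ∀ a b : ℝ, f b - f a = ∫ t in a..b, f' t)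
    (hFisher : Integrable (fun x => f' x ^ 2 / f x))
    (hk_mom : Integrable (fun u => u ^ 2 * k u)) (h : ℝ) :
    ∫ x, (√(∫ u, f (x - h * u) * k u) - √(f x)) ^ 2 ≤
      h ^ 2 * ((∫ x, f' x ^ 2 / f x) / 4) * ∫ u, u ^ 2 * k u := by
  have hI : 0 ≤ ∫ x, f' x ^ 2 / f x := integral_nonneg fun x => div_nonneg (sq_nonneg _) (hf x)
  have hM : 0 ≤ ∫ u, u ^ 2 * k u := integral_nonneg fun u => mul_nonneg (sq_nonneg _) (hk u)
  set ν : Measure ℝ := volume.withDensity fun u => ENNReal.ofReal (k u) with hν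
  have hkm' : Measurable fun u => ENNReal.ofReal (k u) := by fun_prop
  have : IsProbabilityMeasure ν := ⟨by rw [hν, withDensity_apply _ .univ]; simpa using hk_prob⟩
  have hmix : ∀ x, ∫ u, f (x - h * u) * k u = ∫ u, √(f (x - h * u)) ^ 2 ∂ν := by
    intro x
    rw [hν, integral_withDensity_eq_integral_toReal_smul hkm' (by simp)]
    refine integral_congr_ae (Eventually.of_forall fun u => ?_)
    simp [Real.sq_sqrt (hf _), ENNReal.toReal_ofReal (hk u), mul_comm]
  have hJ : ∫⁻ t, ENNReal.ofReal (f' t ^ 2 / f t / 4) =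
      ENNReal.ofReal ((∫ x, f' x ^ 2 / f x) / 4) := by
    rw [← integral_div, ofReal_integral_eq_lintegral_ofReal (hFisher.div_const 4)]
    exact Eventually.of_forall fun x => div_nonneg (div_nonneg (sq_nonneg _) (hf x)) (by norm_num)
  have hmom : ∫⁻ u, ENNReal.ofReal (u ^ 2) ∂ν = ENNReal.ofReal (∫ u, u ^ 2 * k u) := by
    rw [hν, lintegral_withDensity_eq_lintegral_mul _ hkm' (by fun_prop),
      ofReal_integral_eq_lintegral_ofReal hk_mom
        (Eventually.of_forall fun u => mul_nonneg (sq_nonneg _) (hk u))]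
    refine lintegral_congr fun u => ?_
    rw [Pi.mul_apply, mul_comm, ENNReal.ofReal_mul (sq_nonneg _)]
  rw [← ENNReal.ofReal_le_ofReal_iff (by positivity)]
  calc _ ≤ ∫⁻ x, ENNReal.ofReal ((√(∫ u, f (x - h * u) * k u) - √(f x)) ^ 2) :=
        ofReal_integral_le_lintegral_ofReal fun x => sq_nonneg _
    _ ≤ ∫⁻ x, ∫⁻ u, ENNReal.ofReal ((√(f (x - h * u)) - √(f x)) ^ 2) ∂ν := by
        refine lintegral_mono fun x => ?_
        rw [hmix]
        exact sq_sqrt_integral_sq_sub_le ν (by fun_prop) (Real.sqrt_nonneg _)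
    _ = ∫⁻ u, (∫⁻ x, ENNReal.ofReal ((√(f (x - h * u)) - √(f x)) ^ 2)) ∂ν :=
        lintegral_lintegral_swap (by fun_prop)
    _ ≤ ∫⁻ u, ENNReal.ofReal (h ^ 2 * ((∫ x, f' x ^ 2 / f x) / 4)) * ENNReal.ofReal (u ^ 2) ∂ν := by
        refine lintegral_mono fun u => ?_
        refine (lintegral_sq_sqrt_sub_sqrt_le hfm hfm' hf hloc hAC (h * u)).trans_eq ?_
        rw [hJ, ← ENNReal.ofReal_mul (sq_nonneg _), ← ENNReal.ofReal_mul (by positivity)]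
        congr 1
        ring
    _ = _ := by
        rw [lintegral_const_mul' _ _ ENNReal.ofReal_ne_top, hmom,
          ← ENNReal.ofReal_mul (by positivity)]

/-- Let `f` be an absolutely continuous probability density on `ℝ` with a.e.
derivative `f′`, satisfying condition (F.2) with `j = 2` and with finite Fisher information
`I(f) = ∫ (f′)²/f`.  Let `k₁` be a probability density with `∫ u² k₁(u) du < ∞` and
`qₙ(x) = ∫ f(x − n^{-1/2}u) k₁(u) du`.  Then
`limsup_n n ∫ (√qₙ − √f)² dx ≤ 2 I(f) ∫ u² k₁(u) du < ∞`. -/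
theorem limsup_hellinger_sq_bound
    (f f' k₁ : ℝ → ℝ)
    (hf_meas : Measurable f) (hf'_meas : Measurable f') (hk_meas : Measurable k₁)
    (hf_nonneg : ∀ x, 0 ≤ f x) (hk_nonneg : ∀ x, 0 ≤ k₁ x)
    (hf_prob : ∫⁻ x, ENNReal.ofReal (f x) = 1)
    (hk_prob : ∫⁻ x, ENNReal.ofReal (k₁ x) = 1)
    -- (F.1): absolute continuity of `f` with a.e. derivative `f'`
    (hf_AC : ∀ a b : ℝ, f b - f a = ∫ t in a..b, f' t)
    -- (F.2) with j = 2, including finiteness of the Fisher information I(f)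
    (hF2 : ∀ u : ℝ, Tendsto (fun t : ℝ => ∫ x, |f' (x - t * u)| ^ 2 / f x) (𝓝 0)
        (𝓝 (∫ x, |f' x| ^ 2 / f x)))
    (hFisher : Integrable (fun x => (f' x) ^ 2 / f x))
    -- second moment of k₁ is finite
    (hk_mom : Integrable (fun u => u ^ 2 * k₁ u))
    (q : ℕ → ℝ → ℝ)
    (hq : ∀ n x, q n x = ∫ u, f (x - (n : ℝ) ^ (-(1 : ℝ) / 2) * u) * k₁ u) :
    Filter.limsup
        (fun n : ℕ => (n : ℝ) * ∫ x, (Real.sqrt (q n x) - Real.sqrt (f x)) ^ 2) atTop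
      ≤ 2 * (∫ x, (f' x) ^ 2 / f x) * ∫ u, u ^ 2 * k₁ u := by
  have hloc := locallyIntegrable_of_sub_eq_integral hf_prob hf_AC
  have hI : 0 ≤ ∫ x, f' x ^ 2 / f x :=
    integral_nonneg fun x => div_nonneg (sq_nonneg _) (hf_nonneg x)
  have hM : 0 ≤ ∫ u, u ^ 2 * k₁ u :=
    integral_nonneg fun u => mul_nonneg (sq_nonneg _) (hk_nonneg u)
  have hnonneg : ∀ n : ℕ, 0 ≤ (n : ℝ) * ∫ x, (√(q n x) - √(f x)) ^ 2 := fun n =>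
    mul_nonneg n.cast_nonneg (integral_nonneg fun x => sq_nonneg _)
  refine limsup_le_of_le (isCoboundedUnder_le_of_le atTop (x := 0) hnonneg) ?_
  filter_upwards [eventually_gt_atTop 0] with n hn
  have hn' : (0 : ℝ) < n := Nat.cast_pos.2 hn
  have hsq : ((n : ℝ) ^ (-(1 : ℝ) / 2)) ^ 2 = (n : ℝ)⁻¹ := by
    rw [← Real.rpow_natCast, ← Real.rpow_mul hn'.le, ← Real.rpow_neg_one]
    norm_num
  have hb := integral_sq_sqrt_mixture_sub_sqrt_le hf_meas hf'_meas hk_meas hf_nonneg hk_nonneg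
    hk_prob hloc hf_AC hFisher hk_mom ((n : ℝ) ^ (-(1 : ℝ) / 2))
  simp_rw [← hq, hsq] at hb
  calc _ ≤ (n : ℝ) * ((n : ℝ)⁻¹ * ((∫ x, f' x ^ 2 / f x) / 4) * ∫ u, u ^ 2 * k₁ u) := by gcongr
    _ = (∫ x, f' x ^ 2 / f x) * (∫ u, u ^ 2 * k₁ u) / 4 := by field_simp
    _ ≤ _ := by nlinarith [mul_nonneg hI hM]
end

section
/- Let f be an absolutely continuous probability density on ℝ with a.e. derivative f′, satisfying condition (F.2) with j = 2 and j = 3 (so in particular I(f) = ∫ (f′)²/f < ∞ and ∫ |f′|³/f² < ∞). Let k₁ be a probability density on ℝ with ∫ |u|³ k₁(u) du < ∞, let q_n(x) = ∫ f(x − n^{-1/2}u) k₁(u) du, and let Q_n denote the law with density q_n. Then for every sequence c_n → ∞, n·Q_n{ q_n(X)/f(X) ≥ c_n } → 0, where X has law Q_n. -/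
open MeasureTheory Filter Topology

/-- A function on the line that is recovered from `f'` by interval integrals and has finite
nonzero mass cannot be such that `f'` fails to be locally integrable. -/
lemma locallyIntegrable_of_sub_eq_intervalIntegral {f f' : ℝ → ℝ}
    (hf_prob : ∫⁻ x, ENNReal.ofReal (f x) = 1)
    (hf_AC : ∀ a b : ℝ, f b - f a = ∫ t in a..b, f' t) : LocallyIntegrable f' := by
  by_contra hcon
  simp only [LocallyIntegrable, not_forall] at hcon
  obtain ⟨x₀, hx₀⟩ := hcon
  have key : ∀ a b : ℝ, a < x₀ → x₀ < b → f b = f a := by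
    intro a b ha hb
    have hni : ¬ IntervalIntegrable f' volume a b := by
      intro h
      rw [intervalIntegrable_iff_integrableOn_Ioo_of_le (ha.trans hb).le] at h
      exact hx₀ ⟨Set.Ioo a b, Ioo_mem_nhds ha hb, h⟩
    have := hf_AC a b
    rw [intervalIntegral.integral_undef hni] at this
    linarith
  have hconst : ∀ x, x ≠ x₀ → f x = f (x₀ + 1) := by
    intro x hx
    rcases lt_or_gt_of_ne hx with h | h
    · exact (key x (x₀ + 1) h (by linarith)).symm
    · rw [key (x₀ - 1) x (by linarith) h, key (x₀ - 1) (x₀ + 1) (by linarith) (by linarith)]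
  have hae : (fun x => ENNReal.ofReal (f x)) =ᵐ[volume]
      fun _ => ENNReal.ofReal (f (x₀ + 1)) := by
    filter_upwards [Measure.ae_ne volume x₀] with x hx
    rw [hconst x hx]
  rw [lintegral_congr_ae hae, lintegral_const, Real.volume_univ] at hf_prob
  by_cases h0 : ENNReal.ofReal (f (x₀ + 1)) = 0
  · simp [h0] at hf_prob
  · simp [ENNReal.mul_top h0] at hf_prob

/-- The Fisher information of an absolutely continuous probability density is positive. -/
lemma fisherInformation_pos {f f' : ℝ → ℝ} (hf_nonneg : ∀ x, 0 ≤ f x)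
    (hf_prob : ∫⁻ x, ENNReal.ofReal (f x) = 1)
    (hf_AC : ∀ a b : ℝ, f b - f a = ∫ t in a..b, f' t)
    (hF : Integrable (fun x => |f' x| ^ 2 / f x)) :
    0 < ∫ x, |f' x| ^ 2 / f x := by
  have hnn : 0 ≤ fun x => |f' x| ^ 2 / f x := fun x => div_nonneg (by positivity) (hf_nonneg x)
  refine lt_of_le_of_ne (integral_nonneg hnn) fun h0 => ?_
  have hae := (integral_eq_zero_iff_of_nonneg hnn hF).1 h0.symm
  have hii : ∀ a b, IntervalIntegrable f' volume a b := fun a b =>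
    ((locallyIntegrable_of_sub_eq_intervalIntegral hf_prob hf_AC).integrableOn_isCompact
      isCompact_uIcc).intervalIntegrable
  have hcont : Continuous f := by
    have h : f = fun x => f 0 + ∫ t in (0 : ℝ)..x, f' t := by
      funext x
      rw [← hf_AC 0 x]
      ring
    rw [h]
    exact continuous_const.add (intervalIntegral.continuous_primitive hii 0)
  obtain ⟨x₀, hx₀⟩ : ∃ x, 0 < f x := by
    by_contra! hcon
    simp [ENNReal.ofReal_of_nonpos (hcon _)] at hf_prob
  have hopen : IsOpen {x | f x = f x₀} := by
    rw [Metric.isOpen_iff]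
    intro y hy
    rw [Set.mem_ofPred_eq] at hy
    have hpos : {x | 0 < f x} ∈ 𝓝 y :=
      (isOpen_lt continuous_const hcont).mem_nhds (by simpa [hy] using hx₀)
    obtain ⟨ε, hε, hball⟩ := Metric.mem_nhds_iff.1 hpos
    refine ⟨ε, hε, fun z hz => ?_⟩
    have hsub : Set.uIcc y z ⊆ Metric.ball y ε := by
      rw [← segment_eq_uIcc]
      exact (convex_ball y ε).segment_subset (Metric.mem_ball_self hε) hz
    have hzero : ∫ t in y..z, f' t = 0 := by
      apply intervalIntegral.integral_zero_ae
      filter_upwards [hae] with t ht hmem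
      have hft : 0 < f t := hball (hsub (Set.uIoc_subset_uIcc hmem))
      simpa [hft.ne'] using ht
    have := hf_AC y z
    rw [Set.mem_ofPred_eq]
    linarith
  have hclopen : IsClopen {x | f x = f x₀} := ⟨isClosed_eq hcont continuous_const, hopen⟩
  have huniv := hclopen.eq_univ ⟨x₀, rfl⟩
  have hconst : ∀ x, f x = f x₀ := fun x => (Set.eq_univ_iff_forall.1 huniv x)
  simp only [hconst] at hf_prob
  rw [lintegral_const, Real.volume_univ, ENNReal.mul_top (by simpa using hx₀)] at hf_prob
  simp at hf_prob

/-- If the shifted Fisher integrals converge to the Fisher information, they are bounded, as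
integrals with values in `[0, ∞]`, for all sufficiently small shifts. -/
lemma exists_lintegral_shifted_score_le {f f' : ℝ → ℝ} (hf_nonneg : ∀ x, 0 ≤ f x)
    (hf_prob : ∫⁻ x, ENNReal.ofReal (f x) = 1)
    (hf_AC : ∀ a b : ℝ, f b - f a = ∫ t in a..b, f' t)
    (hF : Integrable (fun x => |f' x| ^ 2 / f x))
    (hlim : Tendsto (fun h : ℝ => ∫ x, |f' (x - h)| ^ 2 / f x) (𝓝 0)
        (𝓝 (∫ x, |f' x| ^ 2 / f x))) :
    ∃ δ > 0, ∃ C : ENNReal, C ≠ ⊤ ∧ ∀ h : ℝ, |h| ≤ δ →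
      ∫⁻ x, ENNReal.ofReal (|f' (x - h)| ^ 2 / f x) ≤ C := by
  have hI := fisherInformation_pos hf_nonneg hf_prob hf_AC hF
  set I := ∫ x, |f' x| ^ 2 / f x
  have hev := hlim (Ioo_mem_nhds hI (show I < 2 * I by linarith))
  obtain ⟨δ, hδ, hball⟩ := Metric.nhds_basis_closedBall.mem_iff.1 (mem_map.1 hev)
  refine ⟨δ, hδ, ENNReal.ofReal (2 * I), ENNReal.ofReal_ne_top, fun h hh => ?_⟩
  have hmem := hball (show h ∈ Metric.closedBall (0 : ℝ) δ by simpa using hh)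
  simp only [Set.mem_preimage, Set.mem_Ioo] at hmem
  have hint : Integrable fun x => |f' (x - h)| ^ 2 / f x := by
    by_contra hcon
    rw [integral_undef hcon] at hmem
    exact lt_irrefl _ hmem.1
  rw [← ofReal_integral_eq_lintegral_ofReal hint
    (ae_of_all _ fun x => div_nonneg (by positivity) (hf_nonneg x))]
  exact ENNReal.ofReal_le_ofReal hmem.2.le

/-- The squared norm of an integral over the unit interval is at most the integral of the
square. -/
lemma ofReal_sq_intervalIntegral_le {g : ℝ → ℝ} (hg : Measurable g) :
    ENNReal.ofReal ((∫ τ in (0 : ℝ)..1, g τ) ^ 2) ≤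
      ∫⁻ τ in Set.Ioc (0 : ℝ) 1, ENNReal.ofReal (|g τ| ^ 2) := by
  have : IsProbabilityMeasure (volume.restrict (Set.Ioc (0 : ℝ) 1)) := ⟨by simp⟩
  set μ := volume.restrict (Set.Ioc (0 : ℝ) 1)
  have hsq : ∀ r : ℝ, ENNReal.ofReal (|r| ^ 2) = ‖r‖ₑ ^ 2 := fun r => by
    rw [ENNReal.ofReal_pow (abs_nonneg r), Real.enorm_eq_ofReal_abs]
  rw [intervalIntegral.integral_of_le zero_le_one, ← sq_abs, hsq]
  simp only [hsq]
  have h1 : eLpNorm g 1 μ ≤ eLpNorm g 2 μ :=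
    eLpNorm_le_eLpNorm_of_exponent_le (by norm_num) hg.aestronglyMeasurable
  calc ‖∫ τ, g τ ∂μ‖ₑ ^ 2 ≤ eLpNorm g 2 μ ^ 2 := by
        gcongr
        refine (enorm_integral_le_lintegral_enorm g).trans ?_
        rwa [← eLpNorm_one_eq_lintegral_enorm]
    _ = ∫⁻ τ, ‖g τ‖ₑ ^ 2 ∂μ := by
        have := eLpNorm_nnreal_pow_eq_lintegral (f := g) (μ := μ) (p := 2) (by norm_num)
        simpa using this

/-- The chi-square type distance between `f` and its translate by `h` is `O(h ^ 2)`. -/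
lemma lintegral_sq_increment_div_le {f f' : ℝ → ℝ} (hf_meas : Measurable f)
    (hf'_meas : Measurable f') (hf_AC : ∀ a b : ℝ, f b - f a = ∫ t in a..b, f' t)
    {δ : ℝ} {C : ENNReal}
    (hC : ∀ h : ℝ, |h| ≤ δ → ∫⁻ x, ENNReal.ofReal (|f' (x - h)| ^ 2 / f x) ≤ C)
    {h : ℝ} (hh : |h| ≤ δ) :
    ∫⁻ x, ENNReal.ofReal ((f (x - h) - f x) ^ 2 / f x) ≤ ENNReal.ofReal (h ^ 2) * C := by
  have hpt : ∀ x, ENNReal.ofReal ((f (x - h) - f x) ^ 2 / f x) ≤ ENNReal.ofReal (h ^ 2) *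
      ∫⁻ τ in Set.Ioc (0 : ℝ) 1, ENNReal.ofReal (|f' (x - h * τ)| ^ 2 / f x) := by
    intro x
    have hinc : f x - f (x - h) = h * ∫ τ in (0 : ℝ)..1, f' (x - h * τ) := by
      have := intervalIntegral.smul_integral_comp_sub_mul (a := 0) (b := 1) f' h x
      rw [hf_AC, ← smul_eq_mul, this]
      simp
    have hfac : (f (x - h) - f x) ^ 2 / f x =
        h ^ 2 * ((∫ τ in (0 : ℝ)..1, f' (x - h * τ)) ^ 2 * (f x)⁻¹) := by
      rw [← neg_sub, hinc]
      ring
    rw [hfac, ENNReal.ofReal_mul (sq_nonneg h), ENNReal.ofReal_mul (sq_nonneg _)]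
    simp only [div_eq_mul_inv]
    simp_rw [ENNReal.ofReal_mul (sq_nonneg |_|)]
    rw [lintegral_mul_const _ (by fun_prop)]
    gcongr
    exact ofReal_sq_intervalIntegral_le (by fun_prop)
  calc ∫⁻ x, ENNReal.ofReal ((f (x - h) - f x) ^ 2 / f x)
      ≤ ∫⁻ x, ENNReal.ofReal (h ^ 2) *
        ∫⁻ τ in Set.Ioc (0 : ℝ) 1, ENNReal.ofReal (|f' (x - h * τ)| ^ 2 / f x) :=
        lintegral_mono hpt
    _ = ENNReal.ofReal (h ^ 2) * ∫⁻ τ in Set.Ioc (0 : ℝ) 1, ∫⁻ x,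
        ENNReal.ofReal (|f' (x - h * τ)| ^ 2 / f x) := by
        rw [lintegral_const_mul' _ _ ENNReal.ofReal_ne_top, lintegral_lintegral_swap]
        apply Measurable.aemeasurable
        simp only [Function.uncurry_def]
        fun_prop
    _ ≤ ENNReal.ofReal (h ^ 2) * ∫⁻ τ in Set.Ioc (0 : ℝ) 1, C := by
        gcongr ENNReal.ofReal (h ^ 2) * ?_
        refine setLIntegral_mono measurable_const fun τ hτ => hC _ ?_
        rw [abs_mul, abs_of_pos hτ.1]
        exact (mul_le_of_le_one_right (abs_nonneg h) hτ.2).trans hh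
    _ = ENNReal.ofReal (h ^ 2) * C := by simp

/-- Tail bound for a mixture `p` of translates of a density `f`, on the set where `p` exceeds
`c * f`. The shifts `s * u` of size at most `δ` are controlled by `C`, the remaining ones by
their total mass. -/
lemma setLIntegral_mixture_le {f : ℝ → ℝ} (hf_meas : Measurable f)
    (hf_prob : ∫⁻ x, ENNReal.ofReal (f x) = 1)
    (κ : Measure ℝ) [IsProbabilityMeasure κ] {δ : ℝ} {C : ENNReal}
    (hC : ∀ h : ℝ, |h| ≤ δ →
      ∫⁻ x, ENNReal.ofReal ((f (x - h) - f x) ^ 2 / f x) ≤ ENNReal.ofReal (h ^ 2) * C)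
    (s : ℝ) {c : ℝ} (hc : 4 ≤ c) :
    ∫⁻ x in {x | 0 < f x ∧ ENNReal.ofReal (c * f x) ≤
        ∫⁻ u, ENNReal.ofReal (f (x - s * u)) ∂κ}, ∫⁻ u, ENNReal.ofReal (f (x - s * u)) ∂κ ≤
      2 * (κ {u | δ < |s * u|} + ENNReal.ofReal c⁻¹ *
        (ENNReal.ofReal (s ^ 2) * C * ∫⁻ u, ENNReal.ofReal (u ^ 2) ∂κ)) := by
  set p : ℝ → ENNReal := fun x => ∫⁻ u, ENNReal.ofReal (f (x - s * u)) ∂κ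
  set B := {x | 0 < f x ∧ ENNReal.ofReal (c * f x) ≤ p x}
  have hc0 : 0 < c := by linarith
  have hjoint : Measurable fun z : ℝ × ℝ => ENNReal.ofReal (f (z.1 - s * z.2)) := by fun_prop
  have hp_meas : Measurable p := hjoint.lintegral_prod_right'
  have hB : MeasurableSet B := by
    apply MeasurableSet.inter
    · exact measurableSet_lt measurable_const hf_meas
    · exact measurableSet_le (by fun_prop) hp_meas
  set S := {u : ℝ | |s * u| ≤ δ}
  have hS : MeasurableSet S := measurableSet_le (by fun_prop) measurable_const
  have hSc : Sᶜ = {u | δ < |s * u|} := by ext; simp [S]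
  have hshift : ∀ h : ℝ, ∫⁻ x, ENNReal.ofReal (f (x - h)) = 1 := fun h => by
    rw [lintegral_sub_right_eq_self (fun x => ENNReal.ofReal (f x)) h, hf_prob]
  have hmix : ∀ T : Set ℝ, ∫⁻ x, ∫⁻ u in T, ENNReal.ofReal (f (x - s * u)) ∂κ = κ T := by
    intro T
    rw [lintegral_lintegral_swap hjoint.aemeasurable]
    simp [hshift]
  have hp_fin : ∫⁻ x in B, p x ≠ ⊤ := by
    refine ne_top_of_le_ne_top ENNReal.one_ne_top ((setLIntegral_le_lintegral B p).trans ?_)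
    simpa using (hmix Set.univ).le
  have hW_meas : Measurable fun z : ℝ × ℝ =>
      ENNReal.ofReal ((f (z.1 - s * z.2) - f z.1) ^ 2 / f z.1) := by fun_prop
  have hW : ∫⁻ x, ∫⁻ u in S, ENNReal.ofReal ((f (x - s * u) - f x) ^ 2 / f x) ∂κ ≤
      ENNReal.ofReal (s ^ 2) * C * ∫⁻ u, ENNReal.ofReal (u ^ 2) ∂κ := by
    rw [lintegral_lintegral_swap hW_meas.aemeasurable]
    calc _ ≤ ∫⁻ u in S, ENNReal.ofReal (s ^ 2) * C * ENNReal.ofReal (u ^ 2) ∂κ := by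
          refine setLIntegral_mono (by fun_prop) fun u hu => (hC _ hu).trans_eq ?_
          rw [mul_pow, ENNReal.ofReal_mul (sq_nonneg s)]
          ring
      _ ≤ ∫⁻ u, ENNReal.ofReal (s ^ 2) * C * ENNReal.ofReal (u ^ 2) ∂κ :=
          setLIntegral_le_lintegral _ _
      _ = _ := lintegral_const_mul _ (by fun_prop)
  have hpt : ∀ x ∈ B, p x ≤ 2⁻¹ * p x +
      (∫⁻ u in Sᶜ, ENNReal.ofReal (f (x - s * u)) ∂κ + ENNReal.ofReal c⁻¹ *
        ∫⁻ u in S, ENNReal.ofReal ((f (x - s * u) - f x) ^ 2 / f x) ∂κ) := by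
    rintro x ⟨hfx, hcx⟩
    have hreal : ∀ y : ℝ, y ≤ 2⁻¹ * (c * f x) + c⁻¹ * ((y - f x) ^ 2 / f x) := by
      intro y
      have h1 : y - f x ≤ c * f x / 4 + c⁻¹ * ((y - f x) ^ 2 / f x) := by
        have h2 : c * f x / 4 + c⁻¹ * ((y - f x) ^ 2 / f x) - (y - f x) =
            (y - f x - c * f x / 2) ^ 2 / (c * f x) := by
          field_simp
          ring
        have h3 : 0 ≤ (y - f x - c * f x / 2) ^ 2 / (c * f x) := by positivity
        linarith
      nlinarith
    have hnear : ∫⁻ u in S, ENNReal.ofReal (f (x - s * u)) ∂κ ≤ 2⁻¹ * p x +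
        ENNReal.ofReal c⁻¹ *
          ∫⁻ u in S, ENNReal.ofReal ((f (x - s * u) - f x) ^ 2 / f x) ∂κ := by
      calc _ ≤ ∫⁻ u in S, (2⁻¹ * p x + ENNReal.ofReal c⁻¹ *
            ENNReal.ofReal ((f (x - s * u) - f x) ^ 2 / f x)) ∂κ := by
            refine lintegral_mono fun u => ?_
            refine (ENNReal.ofReal_le_ofReal (hreal _)).trans (ENNReal.ofReal_add_le.trans ?_)
            rw [ENNReal.ofReal_mul (by norm_num : (0 : ℝ) ≤ 2⁻¹),
              ENNReal.ofReal_mul (inv_nonneg.2 hc0.le),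
              ENNReal.ofReal_inv_of_pos two_pos, ENNReal.ofReal_ofNat]
            gcongr
        _ ≤ _ := by
            rw [lintegral_add_left measurable_const,
              lintegral_const_mul' _ _ ENNReal.ofReal_ne_top]
            gcongr
            rw [lintegral_const]
            rw [Measure.restrict_apply_univ]
            exact mul_le_of_le_one_right' prob_le_one
    calc p x = ∫⁻ u in S, ENNReal.ofReal (f (x - s * u)) ∂κ +
          ∫⁻ u in Sᶜ, ENNReal.ofReal (f (x - s * u)) ∂κ := (lintegral_add_compl _ hS).symm
      _ ≤ _ := by
          refine (add_le_add_left hnear _).trans_eq ?_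
          ring
  have hmain : ∫⁻ x in B, p x ≤ 2⁻¹ * (∫⁻ x in B, p x) + (κ {u | δ < |s * u|} +
      ENNReal.ofReal c⁻¹ *
        (ENNReal.ofReal (s ^ 2) * C * ∫⁻ u, ENNReal.ofReal (u ^ 2) ∂κ)) := by
    refine (setLIntegral_mono' hB hpt).trans ?_
    rw [lintegral_add_left (hp_meas.const_mul _), lintegral_const_mul _ hp_meas,
      lintegral_add_left hjoint.lintegral_prod_right',
      lintegral_const_mul' _ _ ENNReal.ofReal_ne_top]
    gcongr
    · refine (setLIntegral_le_lintegral _ _).trans ?_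
      rw [hmix, hSc]
    · exact (setLIntegral_le_lintegral _ _).trans hW
  generalize κ {u | δ < |s * u|} + ENNReal.ofReal c⁻¹ *
        (ENNReal.ofReal (s ^ 2) * C * ∫⁻ u, ENNReal.ofReal (u ^ 2) ∂κ) = Y at hmain ⊢
  generalize ∫⁻ x in B, p x = X at hmain hp_fin ⊢
  rcases eq_or_ne Y ⊤ with rfl | hY
  · simp
  lift X to NNReal using hp_fin
  lift Y to NNReal using hY
  have h2 : (2⁻¹ : ENNReal) = ((2⁻¹ : NNReal) : ENNReal) := by simp
  rw [h2] at hmain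
  norm_cast at hmain ⊢
  rw [← NNReal.coe_le_coe] at hmain ⊢
  push_cast at hmain ⊢
  linarith

/-- Let `f` be an absolutely continuous probability density on `ℝ` with a.e.
derivative `f′`, satisfying (F.2) with `j = 2` and `j = 3` (so `I(f) = ∫(f′)²/f < ∞` and
`∫|f′|³/f² < ∞`).  Let `k₁` be a probability density with `∫|u|³k₁(u)du < ∞`, let
`qₙ(x) = ∫ f(x − n^{-1/2}u)k₁(u)du` and let `Qₙ` be the law with density `qₙ`.  Then for every
sequence `cₙ → ∞`, `n·Qₙ{qₙ(X)/f(X) ≥ cₙ} → 0`. -/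
theorem second_oosterhoff_van_zwet_condition
    (f f' k₁ : ℝ → ℝ)
    (hf_meas : Measurable f) (hf'_meas : Measurable f') (hk_meas : Measurable k₁)
    (hf_nonneg : ∀ x, 0 ≤ f x) (hk_nonneg : ∀ x, 0 ≤ k₁ x)
    (hf_prob : ∫⁻ x, ENNReal.ofReal (f x) = 1)
    (hk_prob : ∫⁻ x, ENNReal.ofReal (k₁ x) = 1)
    -- (F.1): absolute continuity of `f` with a.e. derivative `f'`
    (hf_AC : ∀ a b : ℝ, f b - f a = ∫ t in a..b, f' t)
    -- (F.2) with j = 2 and j = 3, including finiteness of the limit integrals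
    (hF2 : ∀ u : ℝ, Tendsto (fun t : ℝ => ∫ x, |f' (x - t * u)| ^ 2 / f x) (𝓝 0)
        (𝓝 (∫ x, |f' x| ^ 2 / f x)))
    (hF2' : Integrable (fun x => |f' x| ^ 2 / f x))
    (hF3 : ∀ u : ℝ, Tendsto (fun t : ℝ => ∫ x, |f' (x - t * u)| ^ 3 / f x ^ 2) (𝓝 0)
        (𝓝 (∫ x, |f' x| ^ 3 / f x ^ 2)))
    (hF3' : Integrable (fun x => |f' x| ^ 3 / f x ^ 2))
    -- third absolute moment of k₁ is finite
    (hk_mom : Integrable (fun u => |u| ^ 3 * k₁ u))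
    (q : ℕ → ℝ → ℝ)
    (hq : ∀ n x, q n x = ∫ u, f (x - (n : ℝ) ^ (-(1 : ℝ) / 2) * u) * k₁ u)
    (c : ℕ → ℝ) (hc : Tendsto c atTop atTop) :
    Tendsto
      (fun n : ℕ => (n : ENNReal) *
        (volume.withDensity (fun x => ENNReal.ofReal (q n x)))
          {x | c n ≤ q n x / f x})
      atTop (𝓝 0) := by
  obtain ⟨δ, hδ, C, hCtop, hC⟩ := exists_lintegral_shifted_score_le hf_nonneg hf_prob hf_AC hF2'
    (by simpa using hF2 1)
  set κ : Measure ℝ := volume.withDensity fun u => ENNReal.ofReal (k₁ u) with hκ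
  have : IsProbabilityMeasure κ := ⟨by simpa [hκ] using hk_prob⟩
  have hk_ofReal : Measurable fun u => ENNReal.ofReal (k₁ u) := by fun_prop
  set M₃ := ∫⁻ u, ENNReal.ofReal (|u| ^ 3) ∂κ with hM₃
  have hM₃_fin : M₃ ≠ ⊤ := by
    rw [hM₃, hκ, lintegral_withDensity_eq_lintegral_mul _ hk_ofReal (by fun_prop)]
    refine ne_top_of_le_ne_top hk_mom.lintegral_lt_top.ne (lintegral_mono fun u => ?_)
    rw [Pi.mul_apply, mul_comm, ENNReal.ofReal_mul (by positivity)]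
  set M₂ := ∫⁻ u, ENNReal.ofReal (u ^ 2) ∂κ with hM₂
  have hM₂_fin : M₂ ≠ ⊤ := by
    refine ne_top_of_le_ne_top (ENNReal.add_ne_top.2 ⟨ENNReal.one_ne_top, hM₃_fin⟩) ?_
    calc M₂ ≤ ∫⁻ u, (1 + ENNReal.ofReal (|u| ^ 3)) ∂κ := by
          refine lintegral_mono fun u => ?_
          rw [← ENNReal.ofReal_one, ← ENNReal.ofReal_add zero_le_one (by positivity)]
          refine ENNReal.ofReal_le_ofReal ?_
          rw [← sq_abs]
          nlinarith [abs_nonneg u, mul_nonneg (abs_nonneg u) (sq_nonneg (|u| - 1)),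
            sq_nonneg (|u| - 1)]
      _ = 1 + M₃ := by rw [lintegral_add_left measurable_const, lintegral_const, measure_univ, one_mul]
  have hmarkov : ∀ s : ℝ, 0 ≤ s →
      κ {u | δ < |s * u|} ≤ ENNReal.ofReal (s ^ 3) * (M₃ / ENNReal.ofReal (δ ^ 3)) := by
    intro s hs
    rw [← mul_div_assoc, ENNReal.le_div_iff_mul_le (Or.inl (by simpa using pow_pos hδ 3))
      (Or.inl ENNReal.ofReal_ne_top), hM₃, ← lintegral_const_mul _ (by fun_prop), mul_comm]
    refine le_trans ?_ (mul_meas_ge_le_lintegral (by fun_prop) (ENNReal.ofReal (δ ^ 3)))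
    refine mul_le_mul_right (measure_mono fun u hu => ?_) _
    simp only [Set.mem_ofPred_eq] at hu ⊢
    rw [← ENNReal.ofReal_mul (by positivity)]
    refine ENNReal.ofReal_le_ofReal ?_
    rw [← mul_pow, ← abs_of_nonneg hs, ← abs_mul]
    gcongr
  have hbound : ∀ᶠ n : ℕ in atTop, (n : ENNReal) *
        (volume.withDensity (fun x => ENNReal.ofReal (q n x))) {x | c n ≤ q n x / f x} ≤
      2 * (ENNReal.ofReal ((n : ℝ) ^ (-(1 : ℝ) / 2)) * (M₃ / ENNReal.ofReal (δ ^ 3)) +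
        ENNReal.ofReal (c n)⁻¹ * (C * M₂)) := by
    filter_upwards [hc.eventually_ge_atTop 4, eventually_gt_atTop 0] with n hcn hn
    have hn' : (0 : ℝ) < n := by exact_mod_cast hn
    set s : ℝ := (n : ℝ) ^ (-(1 : ℝ) / 2) with hs
    have hs0 : 0 ≤ s := by positivity
    have hs2 : (n : ℝ) * s ^ 2 = 1 := by
      rw [hs, ← Real.rpow_natCast, ← Real.rpow_mul hn'.le]
      norm_num [Real.rpow_neg_one, hn'.ne']
    have hns2 : (n : ENNReal) * ENNReal.ofReal (s ^ 2) = 1 := by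
      rw [← ENNReal.ofReal_natCast, ← ENNReal.ofReal_mul hn'.le, hs2, ENNReal.ofReal_one]
    have hns3 : (n : ENNReal) * ENNReal.ofReal (s ^ 3) = ENNReal.ofReal s := by
      rw [← ENNReal.ofReal_natCast, ← ENNReal.ofReal_mul hn'.le]
      congr 1
      linear_combination s * hs2
    have hqp : ∀ x, ENNReal.ofReal (q n x) ≤ ∫⁻ u, ENNReal.ofReal (f (x - s * u)) ∂κ := by
      intro x
      rw [hq, integral_eq_lintegral_of_nonneg_ae
        (ae_of_all _ fun u => mul_nonneg (hf_nonneg _) (hk_nonneg u))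
        (Measurable.aestronglyMeasurable (by fun_prop)),
        hκ, lintegral_withDensity_eq_lintegral_mul _ hk_ofReal (by fun_prop)]
      refine ENNReal.ofReal_toReal_le.trans (lintegral_mono fun u => ?_)
      rw [Pi.mul_apply, mul_comm, ENNReal.ofReal_mul (hk_nonneg u)]
    have hQ : (volume.withDensity (fun x => ENNReal.ofReal (q n x))) {x | c n ≤ q n x / f x} ≤
        2 * (κ {u | δ < |s * u|} + ENNReal.ofReal (c n)⁻¹ *
          (ENNReal.ofReal (s ^ 2) * C * M₂)) := by
      refine le_trans ?_ (setLIntegral_mixture_le hf_meas hf_prob κ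
        (fun h hh => lintegral_sq_increment_div_le hf_meas hf'_meas hf_AC hC hh) s hcn)
      rw [withDensity_apply']
      refine (lintegral_mono hqp).trans (lintegral_mono_set fun x hx => ?_)
      simp only [Set.mem_ofPred_eq] at hx ⊢
      have hfx : 0 < f x := by
        refine lt_of_le_of_ne (hf_nonneg x) fun h0 => ?_
        rw [← h0, div_zero] at hx
        linarith
      exact ⟨hfx, (ENNReal.ofReal_le_ofReal ((le_div_iff₀ hfx).1 hx)).trans (hqp x)⟩
    calc _ ≤ (n : ENNReal) * (2 * (ENNReal.ofReal (s ^ 3) * (M₃ / ENNReal.ofReal (δ ^ 3)) +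
          ENNReal.ofReal (c n)⁻¹ * (ENNReal.ofReal (s ^ 2) * C * M₂))) := by
          refine mul_le_mul_right (hQ.trans ?_) _
          gcongr
          exact hmarkov s hs0
      _ = 2 * ((n : ENNReal) * ENNReal.ofReal (s ^ 3) * (M₃ / ENNReal.ofReal (δ ^ 3)) +
          ENNReal.ofReal (c n)⁻¹ * ((n : ENNReal) * ENNReal.ofReal (s ^ 2) * (C * M₂))) := by ring
      _ = _ := by rw [hns3, hns2, one_mul]
  refine tendsto_of_tendsto_of_tendsto_of_le_of_le' tendsto_const_nhds ?_
    (Eventually.of_forall fun _ => zero_le) hbound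
  have hs_lim : Tendsto (fun n : ℕ => ENNReal.ofReal ((n : ℝ) ^ (-(1 : ℝ) / 2))) atTop (𝓝 0) := by
    rw [← ENNReal.ofReal_zero]
    refine ENNReal.tendsto_ofReal ?_
    have := (tendsto_rpow_neg_atTop (show (0 : ℝ) < 1 / 2 by norm_num)).comp
      (tendsto_natCast_atTop_atTop (R := ℝ))
    simpa [Function.comp_def, neg_div] using this
  have hc_lim : Tendsto (fun n : ℕ => ENNReal.ofReal (c n)⁻¹) atTop (𝓝 0) := by
    rw [← ENNReal.ofReal_zero]
    exact ENNReal.tendsto_ofReal hc.inv_tendsto_atTop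
  have hA : M₃ / ENNReal.ofReal (δ ^ 3) ≠ ⊤ :=
    ENNReal.div_ne_top hM₃_fin (by simpa using pow_pos hδ 3)
  have h1 := ENNReal.Tendsto.mul_const hs_lim (Or.inr hA)
  have h2 := ENNReal.Tendsto.mul_const hc_lim (Or.inr (ENNReal.mul_ne_top hCtop hM₂_fin))
  have h3 := ENNReal.Tendsto.const_mul (h1.add h2) (Or.inr (ENNReal.ofNat_ne_top (n := 2)))
  simpa using h3
end
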